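/- arXiv:2311.15018 — 15 statements merged into one kernel-verified Lean document; each statement's English description precedes it below -/
import Mathlib

section
/- Let R be a ring of prime characteristic p and let m ≥ 2 be an integer such that m - 1 divides p - 1. Then R is an (m-1)-UU ring if and only if every unit u of R can be written as u = e + q where e^m = e, q is nilpotent, and e*q = q*e. -/
theorem nilp_pow_char {R : Type*} [Ring R] (p : ℕ) (hp : p.Prime) {q : R} (h : IsNilpotent q) :
    ∃ s : ℕ, q ^ (p ^ s) = 0 := by
  obtain ⟨n, hn⟩ := h
  exact ⟨n, pow_eq_zero_of_le (Nat.lt_pow_self hp.one_lt).le hn⟩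

theorem stmt_0 (R : Type*) [Ring R] (p m : ℕ) (hp : p.Prime) [CharP R p]
    (hm : 2 ≤ m) (hdvd : (m - 1) ∣ (p - 1)) :
    (∀ u : Rˣ, IsNilpotent ((u : R) ^ (m - 1) - 1)) ↔
      (∀ u : Rˣ, ∃ e q : R, (u : R) = e + q ∧ e ^ m = e ∧ IsNilpotent q ∧ e * q = q * e) := by
  haveI : Fact p.Prime := ⟨hp⟩
  obtain ⟨k, rfl⟩ : ∃ k, m = k + 1 := ⟨m - 1, by omega⟩
  simp only [Nat.add_sub_cancel] at *
  constructor
  · intro h u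
    obtain ⟨s, hs⟩ := nilp_pow_char p hp (h u)
    rw [sub_pow_char_pow_of_commute _ _ (Commute.one_right _), one_pow, sub_eq_zero, ← pow_mul,
      mul_comm, pow_mul] at hs
    obtain ⟨c, hc⟩ := hdvd
    have hp1 : p = k * c + 1 := by have := hp.pos; omega
    have hfix : ((u : R) ^ p ^ s) ^ p = (u : R) ^ p ^ s := by
      conv_lhs => rw [hp1, pow_succ, pow_mul, ← hp1, hs, one_pow, one_mul]
    have hfix2 : ∀ t : ℕ, ((u : R) ^ p ^ s) ^ p ^ t = (u : R) ^ p ^ s := by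
      intro t
      induction t with
      | zero => simp
      | succ t ih => rw [pow_succ p t, pow_mul, ih, hfix]
    have hcomm : Commute (u : R) ((u : R) ^ p ^ s) := (Commute.refl _).pow_right _
    refine ⟨(u : R) ^ p ^ s, u - (u : R) ^ p ^ s, by abel, ?_, ⟨p ^ s, ?_⟩, ?_⟩
    · rw [pow_succ, hs, one_mul]
    · rw [sub_pow_char_pow_of_commute _ _ hcomm, hfix2, sub_self]
    · exact (hcomm.symm.sub_right (Commute.refl _)).eq
  · intro h u
    obtain ⟨e, q, hu, he, hq, hc⟩ := h u
    obtain ⟨s, hs⟩ := nilp_pow_char p hp hq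
    have hue : (u : R) ^ p ^ s = e ^ p ^ s := by
      rw [hu, add_pow_char_pow_of_commute _ _ hc, hs, add_zero]
    have heu : IsUnit e := by
      rw [← isUnit_pow_iff (n := p ^ s) (pow_ne_zero _ hp.ne_zero), ← hue]
      exact u.isUnit.pow _
    have hek : e ^ k = 1 := by
      apply heu.mul_left_cancel
      rw [← pow_succ', he, mul_one]
    refine ⟨p ^ s, ?_⟩
    rw [sub_pow_char_pow_of_commute _ _ (Commute.one_right _), one_pow, ← pow_mul, mul_comm,
      pow_mul, hue, ← pow_mul, mul_comm, pow_mul, hek, one_pow, sub_self]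
end

section
/- Let D be a division ring and n ≥ 2 an integer. If D is an n-UU ring, then D is commutative (hence a field), D is finite, and the cardinality of D minus 1 divides n. -/
theorem aux_fin (D : Type*) [DivisionRing D] (p : ℕ) [Fact p.Prime] [Algebra (ZMod p) D]
    (s M : Set D) (hM : M.Finite) (h1 : (1 : D) ∈ M) (hs : ∀ a ∈ s, ∀ m ∈ M, a * m ∈ M) :
    Finite (Algebra.adjoin (ZMod p) s) := by
  have hsub : (Submonoid.closure s : Set D) ⊆ M := by
    intro y hy
    induction hy using Submonoid.closure_induction_left with
    | one => exact h1
    | mul_left a ha m _ ih => exact hs a ha m ih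
  have hfin : ((Submonoid.closure s : Set D)).Finite := hM.subset hsub
  have : Module.Finite (ZMod p) (Submodule.span (ZMod p) (Submonoid.closure s : Set D)) :=
    Module.Finite.span_of_finite _ hfin
  have h2 : Finite (Submodule.span (ZMod p) (Submonoid.closure s : Set D)) :=
    Module.finite_of_finite (ZMod p)
  rw [← Algebra.adjoin_eq_span] at h2
  exact h2

theorem aux_eig (K D : Type*) [Field K] [Finite K] [DivisionRing D] (f : K →+* D) (t : K)
    (y : D) (hy : f t * y ≠ y * f t) :
    ∃ k : K, k ≠ 0 ∧ ∃ x : D, x ≠ 0 ∧ f t * x - x * f t = f k * x := by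
  classical
  have := Fintype.ofFinite K
  letI : Module K D := Module.compHom D f
  have hsm : ∀ (k : K) (d : D), k • d = f k * d := fun _ _ => rfl
  obtain ⟨p, hp⟩ := CharP.exists K
  obtain ⟨m, hpp, hcard⟩ := FiniteField.card K p
  haveI : Fact p.Prime := ⟨hpp⟩
  let L : Module.End K D := t • LinearMap.id
  let R : Module.End K D :=
    { toFun := fun d => d * f t
      map_add' := fun a b => add_mul a b _
      map_smul' := fun k d => by simp [hsm, mul_assoc] }
  have hL : ∀ d, L d = f t * d := fun d => rfl
  have hR : ∀ d, R d = d * f t := fun d => rfl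
  have hLR : Commute L R := by
    ext d
    simp [hL, hR, mul_assoc]
  have hLp : ∀ (j : ℕ) d, (L ^ j) d = f (t ^ j) * d := by
    intro j
    induction j with
    | zero => simp
    | succ j ih => intro d; rw [pow_succ, Module.End.mul_apply, ih, hL, pow_succ, map_mul, mul_assoc]
  have hRp : ∀ (j : ℕ) d, (R ^ j) d = d * f (t ^ j) := by
    intro j
    induction j with
    | zero => simp
    | succ j ih => intro d; rw [pow_succ, Module.End.mul_apply, ih, hR, pow_succ', map_mul, mul_assoc]
  haveI : CharP (Module.End K D) p := charP_of_injective_algebraMap (algebraMap K (Module.End K D)).injective p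
  have hδ : (L - R) ^ (Fintype.card K) = L - R := by
    rw [hcard, sub_pow_char_pow_of_commute _ _ hLR, ← hcard]
    ext d
    simp only [LinearMap.sub_apply, hLp, hRp, FiniteField.pow_card, hL, hR]
  by_contra hcon
  push Not at hcon
  have hprod : (∏ k : K, (Polynomial.X - Polynomial.C k)) = Polynomial.X ^ Fintype.card K - Polynomial.X := by
    have hdeg := FiniteField.X_pow_card_sub_X_natDegree_eq K (Fintype.one_lt_card (α := K))
    have hmon : (Polynomial.X ^ Fintype.card K - Polynomial.X : Polynomial K).Monic :=
      Polynomial.monic_X_pow_sub (by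
        rw [Polynomial.degree_X]; exact_mod_cast Fintype.one_lt_card (α := K))
    have hr := Polynomial.prod_multiset_X_sub_C_of_monic_of_roots_card_eq hmon (by
      rw [FiniteField.roots_X_pow_card_sub_X, hdeg]; rfl)
    rw [FiniteField.roots_X_pow_card_sub_X] at hr
    exact hr
  have hz : Polynomial.aeval (L - R) (∏ k : K, (Polynomial.X - Polynomial.C k)) = 0 := by
    rw [hprod]; simp [hδ]
  have hinj : ∀ s : Finset K, (0 : K) ∉ s → ∀ d,
      Polynomial.aeval (L - R) (∏ k ∈ s, (Polynomial.X - Polynomial.C k)) d = 0 → d = 0 := by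
    intro s
    induction s using Finset.induction_on with
    | empty => intro _ d hd; simpa using hd
    | insert k s hk ih =>
      intro h0 d hd
      rw [Finset.mem_insert, not_or] at h0
      rw [Finset.prod_insert hk, map_mul, Module.End.mul_apply] at hd
      apply ih h0.2
      by_contra hne
      refine hcon k (Ne.symm h0.1) _ hne ?_
      simp only [map_sub, Polynomial.aeval_X, Polynomial.aeval_C, LinearMap.sub_apply,
        Module.algebraMap_end_apply, hL, hR, hsm] at hd
      exact sub_eq_zero.mp hd
  rw [← Finset.prod_erase_mul _ _ (Finset.mem_univ (0 : K))] at hz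
  have h3 := hinj (Finset.univ.erase 0) (by simp) ((L - R) y) (by
    have := LinearMap.congr_fun hz y
    simpa only [map_mul, Polynomial.C_0, sub_zero, Polynomial.aeval_X, Module.End.mul_apply, LinearMap.zero_apply] using this)
  exact hy (sub_eq_zero.mp h3)

theorem aux_comm (D : Type*) [DivisionRing D] (n : ℕ) (hn : 0 < n)
    (h : ∀ u : D, u ≠ 0 → u ^ n = 1) (a b : D) : a * b = b * a := by
  by_contra hab
  have ha0 : a ≠ 0 := by rintro rfl; simp at hab
  obtain ⟨p, hp⟩ := CharP.exists D
  have hp0 : p ≠ 0 := by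
    rintro rfl
    haveI : CharZero D := CharP.charP_to_charZero D
    have h2 := h 2 two_ne_zero
    have h3 : (2 : ℕ) ^ n = 1 := by exact_mod_cast h2
    have := Nat.one_lt_two_pow hn.ne'
    omega
  haveI : Fact p.Prime := ⟨(CharP.char_is_prime_or_zero D p).resolve_right hp0⟩
  letI : Algebra (ZMod p) D := ZMod.algebra D p
  have hpow : ∀ u : D, u ≠ 0 → ∀ k, u ^ k = u ^ (k % n) := by
    intro u hu k
    conv_lhs => rw [← Nat.div_add_mod k n, pow_add, pow_mul, h u hu, one_pow, one_mul]
  let S := Algebra.adjoin (ZMod p) ({a} : Set D)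
  have haS : a ∈ S := Algebra.subset_adjoin rfl
  haveI hSf : Finite S := by
    refine aux_fin D p _ ((fun k => a ^ k) '' Set.Iio n) ((Set.finite_Iio n).image _)
      ⟨0, hn, pow_zero a⟩ ?_
    rintro _ rfl _ ⟨k, -, rfl⟩
    refine ⟨(k + 1) % n, Nat.mod_lt _ hn, ?_⟩
    simp only
    rw [← hpow _ ha0, pow_succ']
  obtain ⟨k, hk0, x, hx0, hx⟩ : ∃ k : S, k ≠ 0 ∧ ∃ x : D, x ≠ 0 ∧ a * x - x * a = k * x := by
    letI : Field S := (Finite.isDomain_to_isField S).toField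
    exact aux_eig S D S.val.toRingHom ⟨a, haS⟩ b hab
  have hconj : ∀ s ∈ S, ∃ s' ∈ S, x * s = s' * x := by
    intro s hs
    induction hs using Algebra.adjoin_induction with
    | mem s hs =>
      obtain rfl := hs
      exact ⟨s - k, S.sub_mem haS k.2, by rw [sub_mul, ← hx]; abel⟩
    | algebraMap r => exact ⟨_, S.algebraMap_mem r, (Algebra.commutes r x).symm⟩
    | add u v _ _ hu hv =>
      obtain ⟨u', hu', hu⟩ := hu
      obtain ⟨v', hv', hv⟩ := hv
      exact ⟨u' + v', S.add_mem hu' hv', by rw [mul_add, add_mul, hu, hv]⟩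
    | mul u v _ _ hu hv =>
      obtain ⟨u', hu', hu⟩ := hu
      obtain ⟨v', hv', hv⟩ := hv
      exact ⟨u' * v', S.mul_mem hu' hv', by rw [← mul_assoc, hu, mul_assoc, hv, mul_assoc]⟩
  let T := Algebra.adjoin (ZMod p) ({a, x} : Set D)
  have haT : a ∈ T := Algebra.subset_adjoin (by simp)
  have hxT : x ∈ T := Algebra.subset_adjoin (by simp)
  haveI hTf : Finite T := by
    refine aux_fin D p _ (Set.image2 (fun s k => s * x ^ k) (S : Set D) (Set.Iio n))
      (Set.Finite.image2 _ (Set.toFinite _) (Set.finite_Iio n))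
      ⟨1, S.one_mem, 0, hn, by simp⟩ ?_
    rintro c hc _ ⟨s, hs, j, hj, rfl⟩
    rcases hc with rfl | hc
    · exact ⟨c * s, S.mul_mem haS hs, j, hj, mul_assoc _ _ _⟩
    · obtain rfl := hc
      obtain ⟨s', hs', he⟩ := hconj s hs
      refine ⟨s', hs', (j + 1) % n, Nat.mod_lt _ hn, ?_⟩
      simp only
      rw [← hpow _ hx0, pow_succ', ← mul_assoc, ← mul_assoc, he]
  have hc := congrArg Subtype.val ((Finite.isDomain_to_isField T).mul_comm ⟨a, haT⟩ ⟨x, hxT⟩)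
  simp only [MulMemClass.mk_mul_mk] at hc
  rw [hc, sub_self] at hx
  rcases mul_eq_zero.mp hx.symm with h0 | h0
  · exact hk0 (Subtype.ext h0)
  · exact hx0 h0

theorem aux_field (F : Type*) [Field F] (n : ℕ) (hn : 0 < n)
    (h : ∀ u : F, u ≠ 0 → u ^ n = 1) : Finite F ∧ (Nat.card F - 1) ∣ n := by
  have hF : Finite F := by
    have hne : (Polynomial.X ^ n - 1 : Polynomial F) ≠ 0 := Polynomial.X_pow_sub_C_ne_zero hn 1
    have hfin : (insert 0 {u : F | (Polynomial.X ^ n - 1 : Polynomial F).IsRoot u}).Finite :=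
      (Polynomial.finite_setOfPred_isRoot hne).insert 0
    refine Set.finite_univ_iff.mp (hfin.subset ?_)
    intro u _
    by_cases hu : u = 0
    · exact Or.inl hu
    · right; simp [h u hu]
  refine ⟨hF, ?_⟩
  rw [← Nat.card_units, ← IsCyclic.exponent_eq_card]
  exact Monoid.exponent_dvd_of_forall_pow_eq_one fun u => Units.ext (by simpa using h u u.ne_zero)

theorem stmt_3 (D : Type*) [DivisionRing D] (n : ℕ) (hn : 2 ≤ n)
    (hUU : ∀ u : Dˣ, IsNilpotent ((u : D) ^ n - 1)) :
    (∀ a b : D, a * b = b * a) ∧ Finite D ∧ (Nat.card D - 1) ∣ n := by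
  have h : ∀ u : D, u ≠ 0 → u ^ n = 1 := fun u hu =>
    sub_eq_zero.mp (hUU (Units.mk0 u hu)).eq_zero
  have hc := aux_comm D n (by omega) h
  refine ⟨hc, ?_⟩
  letI : Field D := { ‹DivisionRing D› with mul_comm := hc }
  exact aux_field D n (by omega) h
end

section
/- Let R be a ring and n ≥ 2 an integer. Then R is strongly n-nil-clean if and only if a - a^n is nilpotent for every a in R. -/
theorem aux_domain {D : Type*} [CommRing D] [IsDomain D] (n : ℕ) (hn : 2 ≤ n) (p : ℕ)
    (hp : p.Prime) (hpD : (p : D) = 0) (h : ∀ x : D, x ^ n = x) (t : ℕ) (x : D) :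
    x ^ (p ^ (n.factorial * t)) = x := by
  classical
  have hdeg : (Polynomial.X ^ n - Polynomial.X : Polynomial D).natDegree = n := by
    rw [Polynomial.natDegree_sub_eq_left_of_natDegree_lt] <;>
      simp only [Polynomial.natDegree_X_pow, Polynomial.natDegree_X]
    omega
  have hq : (Polynomial.X ^ n - Polynomial.X : Polynomial D) ≠ 0 := by
    intro h0
    rw [h0, Polynomial.natDegree_zero] at hdeg
    omega
  have hall : ∀ y : D, y ∈ (Polynomial.X ^ n - Polynomial.X : Polynomial D).roots.toFinset := by
    intro y
    rw [Multiset.mem_toFinset, Polynomial.mem_roots hq]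
    simp [h y]
  letI : Fintype D := ⟨_, hall⟩
  have hcard : Fintype.card D ≤ n := by
    have h1 : Fintype.card D =
      (Polynomial.X ^ n - Polynomial.X : Polynomial D).roots.toFinset.card := rfl
    rw [h1]
    refine (Multiset.toFinset_card_le _).trans ?_
    refine (Polynomial.card_roots' _).trans hdeg.le
  letI : Field D := Fintype.fieldOfDomain D
  haveI : Fact p.Prime := ⟨hp⟩
  haveI : CharP D p := (CharP.charP_iff_prime_eq_zero hp).2 hpD
  obtain ⟨r, -, hr⟩ := FiniteField.card D p
  have hrn : (r : ℕ) ≤ n := by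
    have := Nat.lt_pow_self (n := (r : ℕ)) hp.one_lt
    omega
  obtain ⟨s, hs⟩ := Nat.dvd_factorial r.pos hrn
  rw [hs, mul_assoc, pow_mul, ← hr]
  exact FiniteField.pow_card_pow _ _

theorem aux_prime {S : Type*} [CommRing S] (n : ℕ) (hn : 2 ≤ n)
    (h : ∀ x : S, IsNilpotent (x - x ^ n)) (p : ℕ) (hp : p.Prime) (k : ℕ) (a : S) :
    ∃ f : S, ((p ^ k : ℕ) : S) ∣ f ^ n - f ∧ ∃ m : ℕ, ((p ^ k : ℕ) : S) ∣ (a - f) ^ m := by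
  obtain ⟨l, hl⟩ := h a
  have key : ∀ t, ∃ m : ℕ, (p : S) ∣ (a - a ^ (p ^ (n.factorial * t))) ^ m := by
    intro t
    have : a - a ^ (p ^ (n.factorial * t)) ∈ (Ideal.span {(p : S)}).radical := by
      rw [Ideal.radical_eq_sInf, Submodule.mem_sInf]
      intro (P : Ideal S) ⟨hP, hPp⟩
      haveI : P.IsPrime := hPp
      have h0 : ((p : ℕ) : S ⧸ P) = 0 := by
        have : (p : S) ∈ P := hP (Ideal.mem_span_singleton_self _)
        rw [← map_natCast (Ideal.Quotient.mk P)]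
        exact Ideal.Quotient.eq_zero_iff_mem.2 this
      have hx : ∀ x : S ⧸ P, x ^ n = x := by
        intro x
        obtain ⟨y, rfl⟩ := Ideal.Quotient.mk_surjective x
        have := ((h y).map (Ideal.Quotient.mk P)).eq_zero
        rw [map_sub, map_pow, sub_eq_zero] at this
        exact this.symm
      have := aux_domain n hn p hp h0 hx t (Ideal.Quotient.mk P a)
      rw [← Ideal.Quotient.eq_zero_iff_mem, map_sub, map_pow, this, sub_self]
    obtain ⟨m, hm⟩ := this
    exact ⟨m, Ideal.mem_span_singleton.1 hm⟩
  obtain ⟨m, hm⟩ := key (l + k)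
  have hfac : 0 < n.factorial := n.factorial_pos
  have hle : l + k ≤ n.factorial * (l + k) := Nat.le_mul_of_pos_left _ hfac
  generalize n.factorial * (l + k) = j at hm hle
  refine ⟨a ^ p ^ j, ?_, m * k, ?_⟩
  · -- j = l + i, i ≥ k
    obtain ⟨i, rfl⟩ := Nat.exists_eq_add_of_le (show l ≤ j by omega)
    have h1 : (p : S) ∣ (a ^ n) ^ p ^ l - a ^ p ^ l := by
      obtain ⟨r, hr⟩ := exists_add_pow_prime_pow_eq hp (a ^ n) (a - a ^ n) l
      have hz : (a - a ^ n) ^ p ^ l = 0 :=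
        pow_eq_zero_of_le (Nat.lt_pow_self hp.one_lt).le hl
      rw [hz, add_zero, add_sub_cancel] at hr
      rw [hr]
      refine ⟨-(a ^ n * (a - a ^ n) * r), by ring⟩
    have h2 := dvd_sub_pow_of_dvd_sub h1 i
    have h3 : ((p ^ k : ℕ) : S) ∣ (p : S) ^ (i + 1) := by
      push_cast
      exact pow_dvd_pow _ (by omega)
    refine h3.trans ?_
    convert h2 using 1
    ring
  · rw [pow_mul]
    push_cast
    exact pow_dvd_pow_of_dvd hm k

theorem aux_comm_s4 {S : Type*} [CommRing S] (n : ℕ) (hn : 2 ≤ n)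
    (h : ∀ x : S, IsNilpotent (x - x ^ n)) (a : S) (M : ℕ) : 0 < M →
    ∃ f : S, (M : S) ∣ f ^ n - f ∧ ∃ m : ℕ, (M : S) ∣ (a - f) ^ m := by
  induction M using Nat.recOnPosPrimePosCoprime with
  | zero => intro h; omega
  | one => intro _; exact ⟨0, by simp, 0, by simp⟩
  | prime_pow p k hp hk => intro _; exact aux_prime n hn h p hp k a
  | coprime b c hb hc hbc ihb ihc =>
    intro _
    obtain ⟨f, hf, m, hm⟩ := ihb (by omega)
    obtain ⟨g, hg, m', hm'⟩ := ihc (by omega)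
    have hco : IsCoprime (b : S) (c : S) := by
      have := (Nat.isCoprime_iff_coprime.2 hbc).map (Int.castRingHom S)
      simpa using this
    obtain ⟨u, v, huv⟩ := hco
    -- v c = 1 mod b
    have tr : ∀ (d x y : S), d ∣ x - y → d ∣ y ^ n - y → ∀ m, d ∣ (a - y) ^ m →
        d ∣ x ^ n - x ∧ ∀ k, m ≤ k → d ∣ (a - x) ^ k := by
      intro d x y hxy h1 m h2
      constructor
      · have h3 := hxy.trans (sub_dvd_pow_sub_pow x y n)
        have := (h3.add h1).sub hxy
        convert this using 1
        ring
      · intro k hk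
        have h3 : d ∣ (a - x) ^ k - (a - y) ^ k := by
          refine Dvd.dvd.trans ?_ (sub_dvd_pow_sub_pow (a - x) (a - y) k)
          have := hxy.neg_right
          convert this using 1
          ring
        have := h3.add (h2.trans (pow_dvd_pow _ hk))
        simpa using this
    set x := v * c * f + u * b * g with hx
    have h1 := tr b x f ⟨u * (g - f), by rw [hx]; linear_combination f * huv⟩ hf m hm
    have h2 := tr c x g ⟨v * (f - g), by rw [hx]; linear_combination g * huv⟩ hg m' hm'
    have hco : IsCoprime (b : S) (c : S) := ⟨u, v, huv⟩
    refine ⟨x, ?_, m + m', ?_⟩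
    · push_cast
      exact hco.mul_dvd h1.1 h2.1
    · push_cast
      exact hco.mul_dvd (h1.2 _ (by omega)) (h2.2 _ (by omega))

theorem aux_final {S : Type*} [CommRing S] (n : ℕ) (hn : 2 ≤ n)
    (h : ∀ x : S, IsNilpotent (x - x ^ n)) (a : S) :
    ∃ f : S, f ^ n = f ∧ IsNilpotent (a - f) := by
  obtain ⟨k, hk⟩ := h 2
  have hlt : 2 < 2 ^ n := by
    calc 2 < 2 ^ 2 := by norm_num
      _ ≤ 2 ^ n := Nat.pow_le_pow_right (by norm_num) hn
  have hM : (((2 ^ n - 2) ^ k : ℕ) : S) = 0 := by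
    rw [Nat.cast_pow, Nat.cast_sub hlt.le]
    push_cast
    rw [← neg_sub, neg_pow, hk, mul_zero]
  obtain ⟨f, hf, m, hm⟩ := aux_comm_s4 n hn h a ((2 ^ n - 2) ^ k) (pow_pos (by omega) _)
  rw [hM, zero_dvd_iff] at hf hm
  exact ⟨f, sub_eq_zero.1 hf, m, hm⟩

theorem stmt_4 (R : Type*) [Ring R] (n : ℕ) (hn : 2 ≤ n) :
    (∀ a : R, ∃ f q : R, a = f + q ∧ f ^ n = f ∧ IsNilpotent q ∧ f * q = q * f) ↔
      (∀ a : R, IsNilpotent (a - a ^ n)) := by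
  constructor
  · intro h a
    obtain ⟨f, q, rfl, hf, hq, hc⟩ := h a
    have hc : Commute f q := hc
    have hc2 : Commute (f + q) f := (Commute.refl f).add_left hc.symm
    have h1 := hc2.mul_geom_sum₂ n
    rw [hf, add_sub_cancel_left] at h1
    have h2 : f + q - (f + q) ^ n =
        q * (1 - ∑ i ∈ Finset.range n, (f + q) ^ i * f ^ (n - 1 - i)) := by
      rw [mul_sub, h1]; noncomm_ring
    rw [h2]
    refine Commute.isNilpotent_mul_right ?_ hq
    refine (Commute.one_right q).sub_right (Commute.sum_right _ _ _ fun i _ => ?_)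
    exact ((hc.symm.add_right (Commute.refl q)).pow_right i).mul_right (hc.symm.pow_right _)
  · intro h a
    letI : CommRing (Algebra.adjoin ℤ ({a} : Set R)) :=
      Algebra.adjoinCommRingOfComm ℤ (by
        intro x hx y hy
        rw [Set.mem_singleton_iff] at hx hy
        rw [hx, hy])
    have hS : ∀ x : Algebra.adjoin ℤ ({a} : Set R), IsNilpotent (x - x ^ n) := by
      intro x
      obtain ⟨k, hk⟩ := h x
      exact ⟨k, Subtype.ext hk⟩
    obtain ⟨f, hf, k, hk⟩ := aux_final n hn hS ⟨a, Algebra.self_mem_adjoin_singleton ℤ a⟩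
    have hcom : (f : R) * a = a * f :=
      congrArg Subtype.val (mul_comm f ⟨a, Algebra.self_mem_adjoin_singleton ℤ a⟩)
    refine ⟨f, a - f, by abel, congrArg Subtype.val hf, ⟨k, congrArg Subtype.val hk⟩, ?_⟩
    rw [mul_sub, sub_mul, hcom]
end

section
/- Let R be a ring and n ≥ 2 an integer. Then R is strongly n-nil-clean if and only if R is strongly π-regular and R is an (n-1)-UU ring. -/
/-- Powers of a relation `a = a² c`. -/
theorem aux_iter {R : Type*} [Ring R] (a x : R) (k : ℕ) (h : a ^ k = a ^ (k + 1) * x) (j : ℕ) :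
    a ^ k = a ^ (k + j) * x ^ j := by
  induction j with
  | zero => simp
  | succ j ih =>
    calc a ^ k = a ^ (k + j) * x ^ j := ih
      _ = a ^ j * a ^ k * x ^ j := by rw [← pow_add, add_comm j k]
      _ = a ^ j * (a ^ (k + 1) * x) * x ^ j := by rw [← h]
      _ = a ^ (k + (j + 1)) * x ^ (j + 1) := by
        rw [pow_succ' x, ← mul_assoc, ← mul_assoc, ← pow_add]
        congr 3; omega

theorem aux_sq {R : Type*} [Ring R] (a x : R) (k : ℕ) (h : a ^ k = a ^ (k + 1) * x) :
    a ^ k = (a ^ k) ^ 2 * x ^ k := by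
  rw [← pow_mul, mul_two]; exact aux_iter a x k h k

/-- The trick of Dischinger. -/
theorem aux_reg {R : Type*} [Ring R]
    (H : ∀ a : R, ∃ k : ℕ, 0 < k ∧ ∃ x : R, a ^ k = a ^ (k + 1) * x)
    (a c d : R) (h1 : a = a * a * c) (h2 : c = c * c * d) : a * c * a = a := by
  have e1 : a * c * d = a := by
    calc a * c * d = a * a * c * c * d := by rw [← h1]
      _ = a * a * (c * c * d) := by noncomm_ring
      _ = a := by rw [← h2, ← h1]
  have e2 : a * (a - d) = 0 := by
    have : a * a = a * d := by
      calc a * a = a * (a * c * d) := by rw [e1]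
        _ = a * a * c * d := by noncomm_ring
        _ = a * d := by rw [← h1]
    rw [mul_sub, this, sub_self]
  obtain ⟨k, hk, w, hw⟩ := H (a - d)
  set z := a - d with hz
  have zp : ∀ j : ℕ, z ^ (j + 1) = (-d) ^ j * z := by
    intro j
    induction j with
    | zero => simp
    | succ j ih =>
      have : z * z = -d * z := by
        calc z * z = (a - d) * z := by rw [hz]
          _ = a * z - d * z := by rw [sub_mul]
          _ = -d * z := by rw [e2]; noncomm_ring
      rw [pow_succ, ih, mul_assoc, this, ← mul_assoc, ← pow_succ]
  have cd : ∀ j : ℕ, c ^ (j + 1) * (-d) ^ j = (-1) ^ j * c := by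
    intro j
    induction j with
    | zero => simp
    | succ j ih =>
      have hc : c ^ (j + 1 + 1) * d = c ^ (j + 1) := by
        rw [pow_succ, pow_succ, mul_assoc, mul_assoc, ← mul_assoc c c d, ← h2, ← pow_succ]
      rw [pow_succ' (-d), ← mul_assoc, mul_neg, hc, neg_mul, ih, pow_succ]
      noncomm_ring
  obtain ⟨j, rfl⟩ : ∃ j, k = j + 1 := ⟨k - 1, by omega⟩
  rw [zp, zp] at hw
  have h3 : c ^ (j + 1 + 1) * ((-d) ^ j * z) = c ^ (j + 1 + 1) * ((-d) ^ (j + 1) * z * w) := by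
    rw [hw]
  have h4 : (-1) ^ j * (c * c * z) = (-1) ^ (j + 1) * (c * z * w) := by
    calc (-1) ^ j * (c * c * z) = c * ((-1) ^ j * c) * z := by
          rw [← mul_assoc c, ((Commute.neg_one_right c).pow_right j).eq]; noncomm_ring
      _ = c ^ (j + 1 + 1) * ((-d) ^ j * z) := by
          rw [← cd, pow_succ' c (j + 1)]; simp only [mul_assoc]
      _ = c ^ (j + 1 + 1) * (-d) ^ (j + 1) * z * w := by rw [h3]; simp only [mul_assoc]
      _ = _ := by rw [cd]; simp only [mul_assoc]
  have h5 : c * c * z = - (c * z * w) := by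
    rcases neg_one_pow_eq_or R j with hj | hj <;> rw [pow_succ, hj] at h4
    · simpa using h4
    · have h4' : -(c * c * z) = c * z * w := by simpa using h4
      rw [← h4', neg_neg]
  have h6 : a * c * z = 0 := by
    calc a * c * z = a * a * c * c * z := by rw [← h1]
      _ = a * a * (c * c * z) := by simp only [mul_assoc]
      _ = - (a * a * c * z * w) := by rw [h5]; noncomm_ring
      _ = 0 := by rw [← h1, e2]; simp
  rw [hz, mul_sub, e1] at h6
  exact sub_eq_zero.mp h6

theorem aux_group {R : Type*} [Ring R]
    (H : ∀ a : R, ∃ k : ℕ, 0 < k ∧ ∃ x : R, a ^ k = a ^ (k + 1) * x)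
    (a c d : R) (h1 : a = a * a * c) (h2 : c = c * c * d) :
    ∃ e b : R, a * e = a ∧ e * a = a ∧ a * b = e ∧ b * a = e ∧ e * b = b ∧ b * e = b := by
  have h3 := aux_reg H a c d h1 h2
  have ae : a * (a * c) = a := by rw [← mul_assoc]; exact h1.symm
  have ee : a * c * (a * c) = a * c := by rw [← mul_assoc, h3]
  set e := a * c with he
  have ab : a * (e * c * e) = e := by
    calc a * (e * c * e) = (a * e) * c * e := by simp only [mul_assoc]
      _ = e := by rw [ae, ← he, ee]
  have eb : e * (e * c * e) = e * c * e := by simp only [← mul_assoc, ee]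
  have be : (e * c * e) * e = e * c * e := by simp only [mul_assoc, ee]
  set b := e * c * e with hb
  obtain ⟨k, hk, w, hw⟩ := H b
  have key : ∀ j : ℕ, 0 < j → a ^ j * b ^ j = e := by
    intro j hj
    induction j, hj using Nat.le_induction with
    | base => simpa using ab
    | succ j hj ih =>
      rw [pow_succ a, pow_succ' b, mul_assoc, ← mul_assoc a b, ab]
      obtain ⟨i, rfl⟩ : ∃ i, j = i + 1 := ⟨j - 1, by omega⟩
      rw [pow_succ' b, ← mul_assoc e, eb, ← pow_succ' b, ih]
  have h7 : e = b * w := by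
    calc e = a ^ k * b ^ k := (key k hk).symm
      _ = a ^ k * b ^ k * b * w := by rw [mul_assoc _ _ b, ← pow_succ, mul_assoc, ← hw]
      _ = b * w := by rw [key k hk, eb]
  have h8 : a = e * w := by
    calc a = a * e := ae.symm
      _ = a * (b * w) := by rw [← h7]
      _ = e * w := by rw [← mul_assoc, ab]
  refine ⟨e, b, ae, h3, ab, ?_, eb, be⟩
  rw [h8, ← mul_assoc, be, ← h7]

theorem aux_back {R : Type*} [Ring R] (m : ℕ)
    (H : ∀ a : R, ∃ k : ℕ, 0 < k ∧ ∃ x : R, a ^ k = a ^ (k + 1) * x)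
    (U : ∀ u : Rˣ, IsNilpotent ((u : R) ^ m - 1)) (a : R) :
    IsNilpotent (a ^ (m + 1) - a) := by
  obtain ⟨k, hk, x, hx⟩ := H a
  have h1 := aux_sq a x k hx
  obtain ⟨l, hl, y, hy⟩ := H (x ^ k)
  have h2 := aux_sq _ y l hy
  have h3 : (a ^ k) ^ l = ((a ^ k) ^ l) * ((a ^ k) ^ l) * (x ^ k) ^ l := by
    have := aux_iter (a ^ k) (x ^ k) 1 (by simpa using h1) l
    rw [pow_one] at this
    obtain ⟨i, rfl⟩ : ∃ i, l = i + 1 := ⟨l - 1, by omega⟩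
    calc (a ^ k) ^ (i + 1) = (a ^ k) ^ i * a ^ k := pow_succ _ _
      _ = (a ^ k) ^ i * ((a ^ k) ^ (1 + (i + 1)) * (x ^ k) ^ (i + 1)) := by rw [← this]
      _ = _ := by rw [← mul_assoc, ← pow_add, ← pow_add]; congr 2; omega
  rw [pow_two] at h2
  obtain ⟨e, b, ae, ea, ab, ba, eb, be⟩ := aux_group H _ _ _ h3 h2
  rw [← pow_mul] at ae ea ab ba
  have hN : 0 < k * l := Nat.mul_pos hk hl
  generalize k * l = N at *
  have ee : e * e = e := by nth_rw 1 [← ba]; rw [mul_assoc, ae, ba]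
  have c1 : a * e = e * a * e := by
    calc a * e = a * (a ^ N * b) := by rw [ab]
      _ = a ^ N * a * b := by rw [← mul_assoc, ← pow_succ, pow_succ']
      _ = e * a ^ N * a * b := by rw [ea]
      _ = e * a * (a ^ N * b) := by rw [mul_assoc e, ← pow_succ, pow_succ']; simp only [mul_assoc]
      _ = _ := by rw [ab]
  have c2 : e * a = e * a * e := by
    calc e * a = b * a ^ N * a := by rw [ba]
      _ = b * a * a ^ N := by rw [mul_assoc, ← pow_succ, pow_succ', mul_assoc]
      _ = b * a * (a ^ N * e) := by rw [ae]
      _ = b * a ^ N * a * e := by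
          rw [mul_assoc b, ← mul_assoc a, ← pow_succ', pow_succ]; simp only [mul_assoc]
      _ = _ := by rw [ba]
  have hc : Commute a e := c1.trans c2.symm
  have up : ∀ j, (a * e + (1 - e)) ^ j = a ^ j * e + (1 - e) := by
    intro j
    induction j with
    | zero => simp
    | succ j ih =>
      rw [pow_succ, ih]
      have t1 : a ^ j * e * (a * e) = a ^ (j + 1) * e := by
        rw [mul_assoc, ← mul_assoc e, ← hc.eq, mul_assoc a, ee, ← mul_assoc, ← pow_succ]
      have t2 : a ^ j * e * (1 - e) = 0 := by rw [mul_assoc, mul_sub, ee]; simp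
      have t3 : (1 - e) * (a * e) = 0 := by
        rw [hc.eq, ← mul_assoc, sub_mul, ee]; simp
      have t4 : (1 - e) * (1 - e) = 1 - e := by
        rw [mul_sub, sub_mul, sub_mul, ee]; simp
      rw [add_mul, mul_add, mul_add, t1, t2, t3, t4]; simp
  have un : IsUnit (a * e + (1 - e)) := by
    rw [← isUnit_pow_iff hN.ne', up, ae]
    refine ⟨⟨a ^ N + (1 - e), b + (1 - e), ?_, ?_⟩, rfl⟩
    · have : (1 - e) * b = 0 := by rw [sub_mul, eb]; simp
      rw [add_mul, mul_add, mul_add, this, ab, mul_sub, ae, mul_sub, sub_mul, sub_mul, ee]; simp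
    · have : (1 - e) * a ^ N = 0 := by rw [sub_mul, ea]; simp
      rw [add_mul, mul_add, mul_add, this, ba, mul_sub, be, mul_sub, sub_mul, sub_mul, ee]; simp
  obtain ⟨u, hu⟩ := un
  have hU := U u
  rw [hu, up] at hU
  have e3 : a ^ m * e + (1 - e) - 1 = (a ^ m - 1) * e := by noncomm_ring
  rw [e3] at hU
  obtain ⟨K, hK⟩ := hU
  have hc' : Commute (a ^ m - 1) e := (hc.pow_left m).sub_left (Commute.one_left e)
  have e4 : a ^ (m + 1) - a = (a ^ m - 1) * e * a + (a ^ m - 1) * ((1 - e) * a) := by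
    rw [pow_succ]; noncomm_ring
  have am : Commute a (a ^ m - 1) := (Commute.self_pow a m).sub_right (Commute.one_right a)
  have n2 : IsNilpotent ((1 - e) * a) := by
    refine ⟨N, ?_⟩
    have : Commute (1 - e) a := (Commute.one_left a).sub_left hc.symm
    rw [this.mul_pow]
    obtain ⟨i, rfl⟩ : ∃ i, N = i + 1 := ⟨N - 1, by omega⟩
    rw [pow_succ, mul_assoc, sub_mul, ea]; simp
  have ce : Commute e (1 - e) := (Commute.one_right e).sub_right (Commute.refl e)
  have ca : Commute a (1 - e) := (Commute.one_right a).sub_right hc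
  have cm : Commute (a ^ m - 1) (1 - e) := (Commute.one_right _).sub_right hc'
  rw [e4]
  apply Commute.isNilpotent_add
  · have A1 : Commute ((a ^ m - 1) * e * a) (a ^ m - 1) :=
      ((Commute.refl _).mul_left hc'.symm).mul_left am
    have A2 : Commute ((a ^ m - 1) * e * a) (1 - e) := (cm.mul_left ce).mul_left ca
    have A3 : Commute ((a ^ m - 1) * e * a) a := (am.symm.mul_left hc.symm).mul_left (Commute.refl a)
    exact A1.mul_right (A2.mul_right A3)
  · exact (am.symm.mul_left hc.symm).isNilpotent_mul_right ⟨K, hK⟩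
  · exact (cm.mul_right am.symm).isNilpotent_mul_left n2

theorem aux_fwd {R : Type*} [Ring R] (f q : R) (hq : IsNilpotent q) (h : Commute f q) (n : ℕ) :
    IsNilpotent ((f + q) ^ n - f ^ n) := by
  have hf : Commute f (f + q) := (Commute.refl f).add_right h
  have hqa : Commute q (f + q) := h.symm.add_right (Commute.refl q)
  induction n with
  | zero => simp
  | succ n ih =>
    have : (f + q) ^ (n + 1) - f ^ (n + 1) = (f + q) * ((f + q) ^ n - f ^ n) + q * f ^ n := by
      rw [pow_succ', pow_succ']; noncomm_ring
    rw [this]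
    have B : Commute (f + q) ((f + q) ^ n - f ^ n) :=
      (Commute.self_pow _ n).sub_right (hf.symm.pow_right n)
    have B2 : Commute q ((f + q) ^ n - f ^ n) := (hqa.pow_right n).sub_right (h.symm.pow_right n)
    have B3 : Commute f ((f + q) ^ n - f ^ n) := (hf.pow_right n).sub_right (Commute.self_pow f n)
    apply Commute.isNilpotent_add
    · exact ((hqa.symm.mul_right (hf.symm.pow_right n))).mul_left
        ((B2.symm.mul_right (B3.symm.pow_right n)))
    · exact B.isNilpotent_mul_left ih
    · exact (h.symm.pow_right n).isNilpotent_mul_right hq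


theorem aux_absorb {A : Type*} [CommRing A] (e x : A) (hx : x * e = x) (t : ℕ) (ht : 0 < t) :
    x ^ t * e = x ^ t := by
  obtain ⟨i, rfl⟩ : ∃ i, t = i + 1 := ⟨t - 1, by omega⟩
  rw [pow_succ, mul_assoc, hx]

theorem aux_L1 {A : Type*} [CommRing A] (p k : ℕ) (hp : p.Prime) (e x y : A)
    (hpe : (p : A) ^ k * e = 0) (hx : x * e = x) (hy : y * e = y) (h : IsNilpotent (x - y)) :
    ∃ r0 : ℕ, ∀ r, r0 ≤ r → x ^ p ^ r = y ^ p ^ r := by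
  obtain ⟨N, hN⟩ := h
  have hd : (p : A) ∣ x ^ p ^ N - y ^ p ^ N := by
    obtain ⟨r, hr⟩ := exists_add_pow_prime_pow_eq hp (x - y) y N
    have h0 : (x - y) ^ p ^ N = 0 := pow_eq_zero_of_le (Nat.lt_pow_self hp.one_lt).le hN
    rw [h0, sub_add_cancel] at hr
    exact ⟨(x - y) * y * r, by rw [hr]; ring⟩
  refine ⟨N + k, fun r hr => ?_⟩
  obtain ⟨i, rfl⟩ : ∃ i, r = N + (k + i) := ⟨r - N - k, by omega⟩
  obtain ⟨z, hz⟩ := dvd_sub_pow_of_dvd_sub hd (k + i)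
  rw [← pow_mul, ← pow_mul, ← pow_add] at hz
  have hpos : 0 < p ^ (N + (k + i)) := pow_pos hp.pos _
  have h2 : (x ^ p ^ (N + (k + i)) - y ^ p ^ (N + (k + i))) * e = 0 := by
    rw [hz]
    calc (p : A) ^ (k + i + 1) * z * e = ((p : A) ^ k * e) * (p ^ (i + 1) * z) := by ring
      _ = 0 := by rw [hpe, zero_mul]
  rw [sub_mul, aux_absorb e x hx _ hpos, aux_absorb e y hy _ hpos] at h2
  exact sub_eq_zero.mp h2

theorem aux_L2 {A : Type*} [CommRing A] (p k s : ℕ) (hp : p.Prime) (e x y : A)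
    (hpe : (p : A) ^ k * e = 0) (hee : e * e = e) (hy : y * e = y)
    (h : IsNilpotent (x ^ p ^ s - y ^ p ^ s)) : IsNilpotent (x - y) := by
  obtain ⟨r, hr⟩ := exists_add_pow_prime_pow_eq hp (x - y) y s
  rw [sub_add_cancel] at hr
  have hn : IsNilpotent ((p : A) * e) := by
    refine ⟨k + 1, ?_⟩
    calc ((p : A) * e) ^ (k + 1) = ((p : A) ^ k * e) * (p * e ^ k) := by ring
      _ = 0 := by rw [hpe, zero_mul]
  have h3 : (x - y) ^ p ^ s = (x ^ p ^ s - y ^ p ^ s) - (p * e) * ((x - y) * y * r) := by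
    rw [hr]; linear_combination ((p : A) * (x - y) * r) * hy
  apply IsNilpotent.of_pow (m := p ^ s)
  rw [h3]
  exact Commute.isNilpotent_sub (Commute.all _ _) h ((Commute.all _ _).isNilpotent_mul_right hn)

theorem aux_L3 {A : Type*} [CommRing A] (m t j : ℕ) (b : A) (h : IsNilpotent (b ^ (m + 1) - b)) :
    IsNilpotent (b ^ (t + 1 + j * m) - b ^ (t + 1)) := by
  induction j with
  | zero => simp
  | succ j ih =>
    have : b ^ (t + 1 + (j + 1) * m) - b ^ (t + 1) =
        b ^ (t + j * m) * (b ^ (m + 1) - b) + (b ^ (t + 1 + j * m) - b ^ (t + 1)) := by ring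
    rw [this]
    exact Commute.isNilpotent_add (Commute.all _ _) ((Commute.all _ _).isNilpotent_mul_left h) ih

theorem aux_pigeon (p m r0 : ℕ) (hp : p.Prime) (hm : 0 < m) :
    ∃ r s j : ℕ, r0 ≤ r ∧ p ^ r * p ^ s = p ^ s + j * m := by
  have : NeZero m := ⟨hm.ne'⟩
  obtain ⟨i, j, hij, h⟩ := Finite.exists_ne_map_eq_of_infinite
    (fun i : ℕ => ((p ^ ((r0 + 1) * i) : ℕ) : ZMod m))
  wlog hlt : i < j generalizing i j
  · exact this j i hij.symm h.symm (by omega)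
  obtain ⟨d, rfl⟩ : ∃ d, j = i + (d + 1) := ⟨j - i - 1, by omega⟩
  have h' := (ZMod.natCast_eq_natCast_iff _ _ _).mp h
  have hle : p ^ ((r0 + 1) * i) ≤ p ^ ((r0 + 1) * (i + (d + 1))) :=
    Nat.pow_le_pow_right hp.pos (Nat.mul_le_mul_left _ (by omega))
  obtain ⟨c, hc⟩ := (Nat.modEq_iff_dvd' hle).mp h'
  refine ⟨(r0 + 1) * (d + 1), (r0 + 1) * i, c, by nlinarith, ?_⟩
  rw [← pow_add, ← mul_add, add_comm (d + 1) i, mul_comm c m]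
  omega

theorem aux_prime_s5 {A : Type*} [CommRing A] (p k m : ℕ) (hp : p.Prime) (hm : 0 < m) (e b : A)
    (hpe : (p : A) ^ k * e = 0) (hee : e * e = e) (hb : b * e = b)
    (h : IsNilpotent (b ^ (m + 1) - b)) :
    ∃ f : A, f * e = f ∧ f ^ (m + 1) = f ∧ IsNilpotent (b - f) := by
  obtain ⟨r0, hr0⟩ := aux_L1 p k hp e _ _ hpe (aux_absorb e b hb (m + 1) (by omega)) hb h
  obtain ⟨r, s, j, hr, hrs⟩ := aux_pigeon p m r0 hp hm
  have hf := aux_absorb e b hb (p ^ r) (pow_pos hp.pos _)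
  refine ⟨b ^ p ^ r, hf, ?_, ?_⟩
  · rw [← pow_mul, mul_comm, pow_mul]; exact hr0 r hr
  · apply aux_L2 p k s hp e _ _ hpe hee hf
    rw [← pow_mul, hrs]
    obtain ⟨t, ht⟩ : ∃ t, p ^ s = t + 1 := ⟨p ^ s - 1, by have := pow_pos hp.pos s; omega⟩
    rw [ht, ← isNilpotent_neg_iff, neg_sub]
    exact aux_L3 m t j b h

theorem aux_comm_s5 {A : Type*} [CommRing A] (m : ℕ) (hm : 0 < m) (d : ℕ) (hd : 0 < d) :
    ∀ e b : A, (d : A) * e = 0 → e * e = e → b * e = b → IsNilpotent (b ^ (m + 1) - b) →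
    ∃ f : A, f * e = f ∧ f ^ (m + 1) = f ∧ IsNilpotent (b - f) := by
  induction d using Nat.recOnPosPrimePosCoprime with
  | prime_pow p k hp hk =>
    intro e b h1 h2 h3 h4
    exact aux_prime_s5 p k m hp hm e b (by exact_mod_cast h1) h2 h3 h4
  | zero => omega
  | one =>
    intro e b h1 h2 h3 h4
    have : e = 0 := by simpa using h1
    refine ⟨0, by simp, by simp, ?_⟩
    rw [← h3, this]; simp
  | coprime x y hx hy hxy ihx ihy =>
    intro e b h1 h2 h3 h4
    obtain ⟨u, v, huv⟩ := Nat.isCoprime_iff_coprime.mpr hxy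
    have huv' : (u : A) * x + v * y = 1 := by exact_mod_cast congrArg (Int.cast : ℤ → A) huv
    push_cast at h1
    have o : (v * y * e : A) * (u * x * e) = 0 := by linear_combination (v * u * e : A) * h1
    have i1 : (v * y * e : A) * (v * y * e) = v * y * e := by
      linear_combination (v * y * e : A) * e * huv' - o + (v * y : A) * h2
    have i2 : (u * x * e : A) * (u * x * e) = u * x * e := by
      linear_combination (u * x * e : A) * e * huv' - o + (u * x : A) * h2
    have nil : ∀ g : A, g * g = g → IsNilpotent ((b * g) ^ (m + 1) - b * g) := by
      intro g hg
      have hg' : g ^ (m + 1) = g := IsIdempotentElem.pow_succ_eq m hg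
      have : (b * g) ^ (m + 1) - b * g = (b ^ (m + 1) - b) * g := by
        rw [mul_pow, hg']; ring
      rw [this]
      exact (Commute.all _ _).isNilpotent_mul_right h4
    obtain ⟨f1, a1, a2, a3⟩ := ihx (by omega) (v * y * e) (b * (v * y * e))
      (by linear_combination (v : A) * h1) i1 (by rw [mul_assoc, i1]) (nil _ i1)
    obtain ⟨f2, b1, b2, b3⟩ := ihy (by omega) (u * x * e) (b * (u * x * e))
      (by linear_combination (u : A) * h1) i2 (by rw [mul_assoc, i2]) (nil _ i2)
    have ff : f1 * f2 = 0 := by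
      rw [← a1, ← b1]; linear_combination (f1 * f2) * o
    have pw : ∀ t : ℕ, (f1 + f2) ^ (t + 1) = f1 ^ (t + 1) + f2 ^ (t + 1) := by
      intro t
      induction t with
      | zero => simp
      | succ t ih =>
        rw [pow_succ, ih]
        linear_combination (f1 ^ t + f2 ^ t) * ff
    refine ⟨f1 + f2, ?_, ?_, ?_⟩
    · rw [← a1, ← b1]
      linear_combination (f1 * v * y + f2 * u * x) * h2
    · rw [pw, a2, b2]
    · have : b - (f1 + f2) = (b * (v * y * e) - f1) + (b * (u * x * e) - f2) := by
        linear_combination (-b * e) * huv' - h3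
      rw [this]
      exact Commute.isNilpotent_add (Commute.all _ _) a3 b3

theorem stmt_5 (R : Type*) [Ring R] (n : ℕ) (hn : 2 ≤ n) :
    (∀ a : R, ∃ f q : R, a = f + q ∧ f ^ n = f ∧ IsNilpotent q ∧ f * q = q * f) ↔
      ((∀ a : R, ∃ k : ℕ, 0 < k ∧ ∃ x : R, a ^ k = a ^ (k + 1) * x) ∧
        (∀ u : Rˣ, IsNilpotent ((u : R) ^ (n - 1) - 1))) := by
  obtain ⟨m, rfl⟩ : ∃ m, n = m + 1 := ⟨n - 1, by omega⟩
  rw [Nat.add_sub_cancel]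
  constructor
  · intro H
    have H' : ∀ a : R, IsNilpotent (a * (a ^ m - 1)) := by
      intro a
      obtain ⟨f, q, rfl, hf, hq, hc⟩ := H a
      have h1 := aux_fwd f q hq hc (m + 1)
      have h2 : (f + q) * ((f + q) ^ m - 1) = ((f + q) ^ (m + 1) - f ^ (m + 1)) - q := by
        rw [hf, pow_succ']; noncomm_ring
      rw [h2]
      have hqa : Commute q (f + q) := (show Commute f q from hc).symm.add_right (Commute.refl q)
      refine Commute.isNilpotent_sub (Commute.symm ?_) h1 hq
      exact (hqa.pow_right _).sub_right ((show Commute f q from hc).symm.pow_right _)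
    have am : ∀ a : R, Commute a (a ^ m - 1) := fun a =>
      (Commute.self_pow a m).sub_right (Commute.one_right a)
    refine ⟨fun a => ?_, fun u => ?_⟩
    · obtain ⟨N, hN⟩ := H' a
      have hN1 : (a * (a ^ m - 1)) ^ (N + 1) = 0 := by rw [pow_succ, hN, zero_mul]
      rw [(am a).mul_pow] at hN1
      refine ⟨N + 1, by omega, ?_⟩
      -- `(a^m - 1)^t = ± 1 + a * x`
      have : ∀ t : ℕ, ∃ x : R, (1 - a ^ m) ^ t = 1 - a * x := by
        intro t
        induction t with
        | zero => exact ⟨0, by simp⟩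
        | succ t ih =>
          obtain ⟨x, hx⟩ := ih
          obtain ⟨i, rfl⟩ : ∃ i, m = i + 1 := ⟨m - 1, by omega⟩
          refine ⟨a ^ i + x * (1 - a ^ (i + 1)), ?_⟩
          rw [pow_succ, hx, sub_mul, mul_add, ← pow_succ', ← mul_assoc]
          noncomm_ring
      obtain ⟨x, hx⟩ := this (N + 1)
      refine ⟨x, ?_⟩
      have h3 : (1 - a ^ m) ^ (N + 1) = (-1) ^ (N + 1) * (a ^ m - 1) ^ (N + 1) := by
        rw [← neg_pow, neg_sub]
      have h4 : a ^ (N + 1) * (1 - a ^ m) ^ (N + 1) = 0 := by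
        rw [h3, ← mul_assoc, ((Commute.neg_one_right (a ^ (N + 1))).pow_right _).eq, mul_assoc,
          hN1, mul_zero]
      rw [hx, mul_sub, mul_one, ← mul_assoc, ← pow_succ] at h4
      exact sub_eq_zero.mp h4
    · have h1 := H' (u : R)
      have h2 : (u : R) ^ m - 1 = (↑u⁻¹ : R) * ((u : R) * ((u : R) ^ m - 1)) := by
        rw [← mul_assoc, Units.inv_mul, one_mul]
      have c1 : Commute (↑u⁻¹ : R) (u : R) := by
        rw [Commute, SemiconjBy, Units.inv_mul, Units.mul_inv]
      have c2 : Commute (↑u⁻¹ : R) ((u : R) ^ m - 1) :=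
        (c1.pow_right m).sub_right (Commute.one_right _)
      rw [h2]
      exact (c1.mul_right c2).isNilpotent_mul_left h1
  · rintro ⟨H, U⟩ a
    have key := aux_back m H U
    -- positive characteristic
    obtain ⟨N, hN⟩ := key 2
    have hpos : 0 < (2 ^ (m + 1) - 2) ^ N := by
      apply pow_pos
      have : 2 ^ 2 ≤ 2 ^ (m + 1) := Nat.pow_le_pow_right (by norm_num) hn
      omega
    have hle : 2 ≤ 2 ^ (m + 1) := by
      have : 2 ^ 2 ≤ 2 ^ (m + 1) := Nat.pow_le_pow_right (by norm_num) hn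
      omega
    have hchar : (((2 ^ (m + 1) - 2) ^ N : ℕ) : R) = 0 := by
      rw [← hN]; push_cast [Nat.cast_sub hle]; rfl
    generalize (2 ^ (m + 1) - 2) ^ N = d at hpos hchar
    let φ : Polynomial ℤ →+* R := (Polynomial.aeval a).toRingHom
    have inj := RingHom.kerLift_injective φ
    let b : Polynomial ℤ ⧸ RingHom.ker φ := Ideal.Quotient.mk _ Polynomial.X
    have hb : φ.kerLift b = a := by
      have : φ.kerLift b = φ Polynomial.X := RingHom.kerLift_mk φ _
      rw [this]; simp [φ]
    obtain ⟨f, -, f2, f3⟩ := aux_comm_s5 m (by omega) d hpos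
      (1 : Polynomial ℤ ⧸ RingHom.ker φ) b
      (by apply inj; simpa using hchar) (by simp) (by simp)
      (by
        rw [← IsNilpotent.map_iff inj]
        simpa [hb] using key a)
    refine ⟨φ.kerLift f, φ.kerLift (b - f), ?_, ?_, f3.map _, ?_⟩
    · rw [← map_add, add_sub_cancel, hb]
    · rw [← map_pow, f2]
    · rw [← map_mul, ← map_mul, mul_comm]
end

section
/- Let R be an n-UU ring where n is an odd positive integer. Then the Jacobson radical of R is nil: every element a of R such that 1 - y*a is a unit for all y in R is nilpotent. -/
theorem stmt_8 (R : Type*) [Ring R] (n : ℕ) (hodd : Odd n) (hn : 0 < n)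
    (hUU : ∀ u : Rˣ, IsNilpotent ((u : R) ^ n - 1)) :
    ∀ a : R, (∀ y : R, IsUnit (1 - y * a)) → IsNilpotent a := by
  intro a ha
  have h2 : IsNilpotent (2 : R) := by
    have h := (hUU (-1)).neg
    have e : -(((-1 : Rˣ) : R) ^ n - 1) = 2 := by
      rw [Units.val_neg, Units.val_one, hodd.neg_one_pow]
      norm_num
    rwa [e] at h
  have hnu : IsUnit (n : R) := by
    obtain ⟨k, hk⟩ := hodd
    have hk2 : IsNilpotent ((2 : R) * (k : R)) :=
      (Nat.cast_commute k (2 : R)).symm.isNilpotent_mul_right h2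
    have := hk2.isUnit_one_add
    rw [hk]
    push_cast
    rwa [add_comm]
  obtain ⟨v, hv⟩ := hnu
  obtain ⟨u, hu⟩ := ha 1
  rw [one_mul] at hu
  have hnil := hUU u
  rw [hu] at hnil
  have key : ∑ i ∈ Finset.range n, (1 - a) ^ i
      = n - (∑ i ∈ Finset.range n, ∑ j ∈ Finset.range i, (1 - a) ^ j) * a := by
    have h1 : ∀ i ∈ Finset.range n, (1 - a) ^ i
        = 1 - (∑ j ∈ Finset.range i, (1 - a) ^ j) * a := by
      intro i _
      have := geom_sum_mul (1 - a) i
      rw [sub_sub_cancel_left, mul_neg] at this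
      rw [sub_eq_add_neg 1 (_ * a), this]
      abel
    rw [Finset.sum_congr rfl h1, Finset.sum_sub_distrib, Finset.sum_mul]
    simp
  set G := ∑ i ∈ Finset.range n, (1 - a) ^ i with hG
  have hGu : IsUnit G := by
    have h := v.isUnit.mul
      (ha (↑v⁻¹ * ∑ i ∈ Finset.range n, ∑ j ∈ Finset.range i, (1 - a) ^ j))
    rw [mul_sub, mul_one, mul_assoc, Units.mul_inv_cancel_left, hv, ← key] at h
    exact h
  have hc : Commute G a := by
    apply Commute.sum_left
    intro i _
    exact ((Commute.one_left a).sub_left (Commute.refl a)).pow_left i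
  have hGa : IsNilpotent (G * a) := by
    have := geom_sum_mul (1 - a) n
    rw [sub_sub_cancel_left, mul_neg] at this
    rw [← this] at hnil
    simpa using hnil.neg
  obtain ⟨k, hk⟩ := hGa
  rw [hc.mul_pow] at hk
  exact ⟨k, (hGu.pow k).mul_right_eq_zero.mp hk⟩
end

section
/- Let k be a positive integer and let R be a 2^k-UU ring. Then the Jacobson radical of R is nil: every element a of R such that 1 - y*a is a unit for all y in R is nilpotent. -/
theorem stmt_9 (R : Type*) [Ring R] (k : ℕ) (hk : 0 < k)
    (hUU : ∀ u : Rˣ, IsNilpotent ((u : R) ^ (2 ^ k) - 1)) :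
    ∀ a : R, (∀ y : R, IsUnit (1 - y * a)) → IsNilpotent a := by
  intro a ha
  have hn : 0 < 2 ^ k := by positivity
  generalize 2 ^ k = n at hUU hn
  let φ : Polynomial ℤ →+* R := (Polynomial.aeval a : Polynomial ℤ →ₐ[ℤ] R).toRingHom
  have hφX : φ Polynomial.X = a := by simp [φ]
  let I : Ideal (Polynomial ℤ) := RingHom.ker φ
  have key : ∀ f : Polynomial ℤ, (1 - f * Polynomial.X) ^ n - 1 ∈ I.radical := by
    intro f
    obtain ⟨u, hu⟩ := ha (φ f)
    obtain ⟨m, hm⟩ := hUU u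
    refine ⟨m, ?_⟩
    rw [RingHom.mem_ker]
    simp only [map_pow, map_sub, map_one, map_mul, hφX]
    rw [← hu]
    exact hm
  have hX : (Polynomial.X : Polynomial ℤ) ∈ I.radical := by
    rw [Ideal.radical_eq_sInf, Ideal.mem_sInf]
    rintro p ⟨hIp, hp⟩
    by_contra hXp
    let D := Polynomial ℤ ⧸ p
    let x : D := Ideal.Quotient.mk p Polynomial.X
    have hx : x ≠ 0 := fun h => hXp (Ideal.Quotient.eq_zero_iff_mem.1 h)
    have hroot : ∀ d : D, (1 - d * x) ^ n = 1 := by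
      intro d
      obtain ⟨f, rfl⟩ := Ideal.Quotient.mk_surjective d
      have h1 : (1 - f * Polynomial.X) ^ n - 1 ∈ p :=
        (hp.radical_le_iff.2 hIp) (key f)
      have h2 := Ideal.Quotient.eq_zero_iff_mem.2 h1
      simp only [map_pow, map_sub, map_one, map_mul] at h2
      exact sub_eq_zero.1 h2
    have hfin : Finite D := by
      have hs : Set.Finite {z : D | z ^ n = 1} := by
        refine (Polynomial.nthRootsFinset n (1 : D)).finite_toSet.subset ?_
        intro z hz
        simpa [Polynomial.mem_nthRootsFinset hn] using hz
      have := hs.to_subtype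
      refine Finite.of_injective (fun d : D => (⟨1 - d * x, hroot d⟩ : {z : D | z ^ n = 1})) ?_
      intro d e h
      have h' : 1 - d * x = 1 - e * x := congrArg Subtype.val h
      exact mul_right_cancel₀ hx (sub_right_injective h')
    obtain ⟨y, hy⟩ := (Finite.isField_of_domain D).mul_inv_cancel hx
    have := hroot y
    rw [mul_comm, hy, sub_self, zero_pow hn.ne'] at this
    exact zero_ne_one this
  obtain ⟨m, hm⟩ := hX
  refine ⟨m, ?_⟩
  rw [RingHom.mem_ker, map_pow, hφX] at hm
  exact hm
end

section
/- Let R be a 6-UU ring. Then the Jacobson radical of R is nil: every element a of R such that 1 - y*a is a unit for all y in R is nilpotent. -/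
theorem stmt_10 (R : Type*) [Ring R]
    (hUU : ∀ u : Rˣ, IsNilpotent ((u : R) ^ 6 - 1)) :
    ∀ a : R, (∀ y : R, IsUnit (1 - y * a)) → IsNilpotent a := by
  classical
  intro a ha
  let φ : Polynomial ℤ →ₐ[ℤ] R := Polynomial.aeval a
  have key : (Polynomial.X : Polynomial ℤ) ∈ (RingHom.ker φ).radical := by
    rw [Ideal.radical_eq_sInf, Ideal.mem_sInf]
    rintro P ⟨hP, hprime⟩
    by_contra hX
    have h1 : ∀ d : Polynomial ℤ ⧸ P,
        (1 + Ideal.Quotient.mk P Polynomial.X * d) ^ 6 = 1 := by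
      intro d
      obtain ⟨f, rfl⟩ := Ideal.Quotient.mk_surjective d
      obtain ⟨u, hu⟩ := ha (-(φ f))
      obtain ⟨k, hk⟩ := hUU u
      have h2 : (((1 + f * Polynomial.X) ^ 6 - 1) ^ k : Polynomial ℤ) ∈ RingHom.ker φ := by
        rw [RingHom.mem_ker]
        have h3 : φ (1 + f * Polynomial.X) = u := by
          rw [hu]; simp [φ]
        rw [map_pow, map_sub, map_pow, h3, map_one, hk]
      have h4 := hprime.mem_of_pow_mem _ (hP h2)
      rw [← Ideal.Quotient.eq_zero_iff_mem] at h4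
      rw [mul_comm]
      simpa [sub_eq_zero] using h4
    have hx : Ideal.Quotient.mk P Polynomial.X ≠ 0 := by
      rwa [Ne, Ideal.Quotient.eq_zero_iff_mem]
    have hfin : Finite (Polynomial ℤ ⧸ P) := by
      have hs : (((Polynomial.nthRoots 6 (1 : Polynomial ℤ ⧸ P)).toFinset :
          Set (Polynomial ℤ ⧸ P))).Finite := Finset.finite_toSet _
      have := hs.to_subtype
      refine Finite.of_injective (β := (((Polynomial.nthRoots 6
        (1 : Polynomial ℤ ⧸ P)).toFinset : Set (Polynomial ℤ ⧸ P))))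
        (fun d => ⟨1 + Ideal.Quotient.mk P Polynomial.X * d, ?_⟩) ?_
      · simp [Polynomial.mem_nthRoots, h1]
      · intro d e hde
        have := congrArg Subtype.val hde
        exact mul_left_cancel₀ hx (add_left_cancel this)
    obtain ⟨d, hd⟩ := (Finite.isField_of_domain (Polynomial ℤ ⧸ P)).mul_inv_cancel hx
    have := h1 (-d)
    rw [mul_neg, hd] at this
    simp at this
  obtain ⟨k, hk⟩ := key
  refine ⟨k, ?_⟩
  rw [RingHom.mem_ker] at hk
  simpa [φ] using hk
end

section
/- Let R be a 10-UU ring. Then the Jacobson radical of R is nil: every element a of R such that 1 - y*a is a unit for all y in R is nilpotent. -/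
theorem stmt_11 (R : Type*) [Ring R]
    (hUU : ∀ u : Rˣ, IsNilpotent ((u : R) ^ 10 - 1)) :
    ∀ a : R, (∀ y : R, IsUnit (1 - y * a)) → IsNilpotent a := by
  intro a ha
  let φ : Polynomial ℤ →ₐ[ℤ] R := Polynomial.aeval a
  let I : Ideal (Polynomial ℤ) := RingHom.ker φ
  have hφX : φ Polynomial.X = a := Polynomial.aeval_X a
  have key : ∀ q : Polynomial ℤ, (1 - q * Polynomial.X) ^ 10 - 1 ∈ I.radical := by
    intro q
    obtain ⟨u, hu⟩ := ha (φ q)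
    obtain ⟨m, hm⟩ := hUU u
    refine ⟨m, ?_⟩
    rw [RingHom.mem_ker]
    rw [hu] at hm
    simpa [hφX] using hm
  have hX : Polynomial.X ∈ I.radical := by
    rw [Ideal.radical_eq_sInf, Ideal.mem_sInf]
    rintro P ⟨hIP, hP⟩
    by_contra hXP
    let x : Polynomial ℤ ⧸ P := Ideal.Quotient.mk P Polynomial.X
    have hx : x ≠ 0 := fun h => hXP (Ideal.Quotient.eq_zero_iff_mem.mp h)
    have key2 : ∀ q : Polynomial ℤ, (1 - Ideal.Quotient.mk P q * x) ^ 10 = 1 := by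
      intro q
      have h := Ideal.Quotient.eq_zero_iff_mem.mpr ((hP.radical_le_iff.mpr hIP) (key q))
      rw [map_sub, map_pow, map_sub, map_mul, map_one] at h
      exact sub_eq_zero.mp h
    have hpow : ∀ k : ℕ, (1 - x ^ (k + 1)) ^ 10 = 1 := by
      intro k
      have h := key2 (Polynomial.X ^ k)
      rwa [map_pow, ← pow_succ] at h
    let f : ℕ → (Polynomial.nthRootsFinset 10 (1 : Polynomial ℤ ⧸ P)) := fun k =>
      ⟨1 - x ^ (k + 1), (Polynomial.mem_nthRootsFinset (by norm_num) 1).mpr (hpow k)⟩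
    obtain ⟨i, j, hij, hf⟩ := Finite.exists_ne_map_eq_of_infinite f
    have hf' : x ^ (i + 1) = x ^ (j + 1) := by
      have := congrArg Subtype.val hf
      exact sub_right_injective this
    have fin : ∀ i j : ℕ, i < j → x ^ (i + 1) = x ^ (j + 1) → False := by
      intro i j hlt h
      obtain ⟨d, rfl⟩ := Nat.exists_eq_add_of_lt hlt
      have h1 : x ^ (d + 1) = 1 := by
        apply mul_left_cancel₀ (pow_ne_zero (i + 1) hx)
        rw [← pow_add, mul_one, h]
        congr 1
        omega
      have h2 := hpow d
      rw [h1] at h2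
      simp at h2
    rcases lt_or_gt_of_ne hij with h | h
    · exact fin i j h hf'
    · exact fin j i h hf'.symm
  obtain ⟨m, hm⟩ := hX
  refine ⟨m, ?_⟩
  rw [RingHom.mem_ker] at hm
  simpa [hφX] using hm
end

section
/- Let n be an odd positive integer. A ring R is an n-UU ring if and only if both of the following hold: (1) the element 2 of R is nilpotent; (2) R is a (2^k · n)-UU ring for every positive integer k. -/
theorem stmt_13 (R : Type*) [Ring R] (n : ℕ) (hodd : Odd n) (hn : 0 < n) :
    (∀ u : Rˣ, IsNilpotent ((u : R) ^ n - 1)) ↔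
      (IsNilpotent (2 : R) ∧
        ∀ k : ℕ, 0 < k → ∀ u : Rˣ, IsNilpotent ((u : R) ^ (2 ^ k * n) - 1)) := by
  constructor
  · intro h
    refine ⟨?_, fun k _ u => ?_⟩
    · have h1 := h (-1)
      have e : (((-1 : Rˣ) : R) ^ n - 1) = -2 := by
        rw [Units.val_neg, Units.val_one, hodd.neg_one_pow]
        norm_num
      rw [e] at h1
      exact isNilpotent_neg_iff.mp h1
    · have h1 := h (u ^ (2 ^ k))
      rwa [Units.val_pow_eq_pow_val, ← pow_mul] at h1
  · rintro ⟨h2, h⟩ u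
    have h1 := h 1 one_pos u
    rw [pow_one, mul_comm, pow_mul] at h1
    generalize (u : R) ^ n = v at h1 ⊢
    have hc : Commute (2 : R) (v - 1) := Commute.ofNat_left 2 _
    have h3 : IsNilpotent (2 * (v - 1)) := hc.isNilpotent_mul_right h2
    have e : (v - 1) ^ 2 = (v ^ 2 - 1) - 2 * (v - 1) := by noncomm_ring
    have hcv : Commute (v ^ 2 - 1) (2 * (v - 1)) := by
      have : Commute (v ^ 2 - 1) (v - 1) := by
        unfold Commute SemiconjBy
        noncomm_ring
      exact (Commute.ofNat_right _ 2).mul_right this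
    have h4 : IsNilpotent ((v - 1) ^ 2) := by
      rw [e]
      exact hcv.isNilpotent_sub h1 h3
    exact h4.of_pow
end

section
/- A ring R is strongly nil-clean if and only if both of the following hold: (1) R is nil-clean, i.e., every element of R is a sum of an idempotent and a nilpotent; (2) R is a 2^k-UU ring for every positive integer k. -/
lemma aux_swap {R : Type*} [Ring R] {x y : R} (h : IsNilpotent (x * y)) : IsNilpotent (y * x) := by
  obtain ⟨n, hn⟩ := h
  refine ⟨n + 1, ?_⟩
  have : ∀ m : ℕ, (y * x) ^ (m + 1) = y * (x * y) ^ m * x := by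
    intro m
    induction m with
    | zero => simp
    | succ m ih => rw [pow_succ, ih, pow_succ]; noncomm_ring
  rw [this, hn]; simp

/-- product of square-zero elements in a UU ring -/
lemma aux_xy {R : Type*} [Ring R] (huu : ∀ u : Rˣ, IsNilpotent ((u : R) - 1)) {x y : R}
    (hx : x * x = 0) (hy : y * y = 0) : IsNilpotent (x * y) := by
  have ux : IsUnit (1 + x) := IsNilpotent.isUnit_one_add ⟨2, by rw [sq, hx]⟩
  have uy : IsUnit (1 + y) := IsNilpotent.isUnit_one_add ⟨2, by rw [sq, hy]⟩
  obtain ⟨u, hu⟩ := ux.mul uy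
  have hw := huu u
  rw [hu] at hw
  set z := x * y + y * x with hz
  have hxz : x * z = z * x := by
    simp only [hz, mul_add, add_mul, ← mul_assoc, hx, zero_mul, zero_add]
    simp only [mul_assoc, hx, mul_zero, add_zero]
  have hyz : y * z = z * y := by
    simp only [hz, mul_add, add_mul, ← mul_assoc, hy, zero_mul, add_zero]
    simp only [mul_assoc, hy, mul_zero, zero_add]
  have cz : Commute z ((u : R)) := by
    rw [hu]
    have h1 : Commute z x := hxz.symm
    have h2 : Commute z y := hyz.symm
    exact ((Commute.one_right z).add_right h1).mul_right ((Commute.one_right z).add_right h2)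
  have key : ((1 + x) * (1 + y) - 1) * ((1 + x) * (1 + y) - 1) = z * (u : R) := by
    rw [hu]
    have e1 : (1 + x) * (1 + y) - 1 = x + y + x * y := by noncomm_ring
    have e2 : z * ((1 + x) * (1 + y)) = z + z * x + z * y + z * x * y := by noncomm_ring
    rw [e1, e2, ← hxz, ← hyz]
    simp only [hz, mul_add, add_mul, ← mul_assoc, hx, hy, zero_mul, add_zero, zero_add]
    simp only [mul_assoc, hx, hy, mul_zero, add_zero, zero_add]
    abel
  have nz : IsNilpotent (z * (u : R)) := by
    rw [← key]
    exact (Commute.refl _).isNilpotent_mul_left hw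
  have nz' : IsNilpotent z := by
    obtain ⟨n, hn⟩ := nz
    refine ⟨n, ?_⟩
    rw [cz.mul_pow] at hn
    have := (u ^ n).isUnit.mul_left_eq_zero.mp (by simpa using hn)
    exact this
  have hxyz : Commute z (x * y) := Commute.mul_right hxz.symm hyz.symm
  have : x * y * (x * y) = z * (x * y) := by
    simp only [hz, add_mul]
    have : y * x * (x * y) = 0 := by
      rw [mul_assoc, ← mul_assoc x x, hx]; simp
    rw [this, add_zero]
  have : IsNilpotent ((x * y) ^ 2) := by
    rw [sq, this]; exact hxyz.isNilpotent_mul_right nz'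
  obtain ⟨n, hn⟩ := this
  exact ⟨2 * n, by rw [pow_mul, hn]⟩

lemma aux_lift {R : Type*} [Ring R] {a : R} (h : IsNilpotent (a - a ^ 2)) :
    ∃ e q : R, a = e + q ∧ e ^ 2 = e ∧ IsNilpotent q ∧ e * q = q * e := by
  obtain ⟨n, hn⟩ := h
  have hn : (a - a ^ 2) ^ (n + 1) = 0 := by rw [pow_succ, hn, zero_mul]
  set m := n + 1 with hm
  have hid := isIdempotentElem_one_sub_one_sub_pow_pow a m hn
  set e := 1 - (1 - a ^ m) ^ m with he
  have ce : Commute a e := by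
    rw [he]
    exact (Commute.one_right a).sub_right (((Commute.one_right a).sub_right
      ((Commute.refl a).pow_right m)).pow_right m)
  refine ⟨e, a - e, by abel, by rw [sq]; exact hid, ?_, ?_⟩
  · open Polynomial in
    have hd : (X - X ^ 2 : ℤ[X]) ∣ X - (1 - (1 - X ^ m) ^ m) := by
      have h0 : (X : ℤ[X]) ∣ X - (1 - (1 - X ^ m) ^ m) := by
        rw [X_dvd_iff, coeff_zero_eq_eval_zero]; simp [hm]
      have h1 : (1 - X : ℤ[X]) ∣ X - (1 - (1 - X ^ m) ^ m) := by
        rw [← neg_dvd, neg_sub, ← C_1, dvd_iff_isRoot]; simp [hm]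
      have : (X - X ^ 2 : ℤ[X]) = X * (1 - X) := by ring
      rw [this]
      exact IsCoprime.mul_dvd ⟨1, 1, by ring⟩ h0 h1
    obtain ⟨p, hp⟩ := hd
    have := congrArg (Polynomial.aeval a) hp
    simp only [map_sub, map_mul, map_pow, Polynomial.aeval_X, map_one] at this
    rw [← he] at this
    rw [this]
    refine Commute.isNilpotent_mul_right ?_ ⟨m, hn⟩
    have hc : Commute (Polynomial.aeval a (Polynomial.X - Polynomial.X ^ 2 : Polynomial ℤ))
      (Polynomial.aeval a p) := (Commute.all _ _).map _
    simpa using hc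
  · exact (ce.symm.sub_right (Commute.refl e)).eq

lemma aux_two {R : Type*} [Ring R]
    (h : ∀ a : R, ∃ e q : R, a = e + q ∧ e ^ 2 = e ∧ IsNilpotent q) : IsNilpotent (2 : R) := by
  obtain ⟨e, q, h2, he, hq⟩ := h 2
  have hE : e = 2 - q := by rw [h2]; abel
  have : (2 : R) = q * (3 - q) := by
    rw [hE] at he
    have h1 : (2 - q) ^ 2 = 4 - 4 * q + q * q := by
      have : (4:R) = 2 + 2 := by norm_num
      rw [this, sq, mul_sub, sub_mul, sub_mul, add_mul, two_mul (2:R), mul_two q, two_mul q]; abel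
    rw [h1] at he
    have : q * (3 - q) = 2 + (2 - q) - (4 - 4 * q + q * q) := by
      have : (4:R) = 2 + 2 := by norm_num
      rw [this]; noncomm_ring
    rw [this, he]; abel
  rw [this]
  refine Commute.isNilpotent_mul_right ?_ hq
  exact (Commute.ofNat_right q 3).sub_right (Commute.refl q)

lemma aux_uu {R : Type*} [Ring R] (h2 : IsNilpotent (2 : R)) {u : R}
    (hu : IsNilpotent (u ^ 2 - 1)) : IsNilpotent (u - 1) := by
  have : (u - 1) ^ 2 = (u ^ 2 - 1) - 2 * (u - 1) := by noncomm_ring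
  have h3 : IsNilpotent ((u - 1) ^ 2) := by
    rw [this]
    refine Commute.isNilpotent_sub ?_ hu ((Commute.ofNat_left 2 _).isNilpotent_mul_right h2)
    have c : Commute (u ^ 2 - 1) (u - 1) :=
      (((Commute.refl u).pow_left 2).sub_right (Commute.one_right _)).sub_left
        (Commute.one_left _)
    exact (Commute.ofNat_right _ 2).mul_right c
  obtain ⟨n, hn⟩ := h3
  exact ⟨2 * n, by rw [pow_mul, hn]⟩

lemma aux_jac {R : Type*} [Ring R] {x : R} (h : ∀ s : R, IsNilpotent (s * x)) :
    x ∈ Ring.jacobson R := by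
  rw [← Ideal.jacobson_bot, Ideal.mem_jacobson_iff]
  intro y
  obtain ⟨u, hu⟩ := (h y).isUnit_one_add
  refine ⟨(u⁻¹ : Rˣ), ?_⟩
  have : ((u⁻¹ : Rˣ) : R) * (1 + y * x) = 1 := by rw [← hu]; simp
  rw [Ideal.mem_bot, ← sub_eq_zero.mpr this]; noncomm_ring

lemma aux_nil {R : Type*} [Ring R] (huu : ∀ u : Rˣ, IsNilpotent ((u : R) - 1)) {x : R}
    (h : x ∈ Ring.jacobson R) : IsNilpotent x := by
  have key : ∀ j ∈ Ring.jacobson R, ∃ z : R, z * (1 + j) = 1 := by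
    intro j hj
    rw [← Ideal.jacobson_bot, Ideal.mem_jacobson_iff] at hj
    obtain ⟨z, hz⟩ := hj 1
    rw [Ideal.mem_bot] at hz
    exact ⟨z, by rw [← sub_eq_zero, ← hz]; noncomm_ring⟩
  obtain ⟨z, hz⟩ := key x h
  obtain ⟨w, hw⟩ := key (-(z * x)) (neg_mem (Ideal.mul_mem_left _ z h))
  have e : 1 + -(z * x) = z := by rw [← hz]; noncomm_ring
  rw [e] at hw
  have e2 : w = 1 + x := by
    calc w = w * (z * (1 + x)) := by rw [hz, mul_one]
      _ = 1 + x := by rw [← mul_assoc, hw, one_mul]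
  rw [e2] at hw
  have := huu ⟨1 + x, z, hw, hz⟩
  simpa using this

lemma aux_corner {R : Type*} [Ring R] (huu : ∀ u : Rˣ, IsNilpotent ((u : R) - 1)) {e f : R}
    (he : e * e = e) (hf : f * f = f) (hef : e * f = 0) (hfe : f * e = 0) (r : R) :
    e * r * f ∈ Ring.jacobson R := by
  apply aux_jac
  intro s
  apply aux_swap
  have hx : (e * r * f) * (e * r * f) = 0 := by
    calc (e * r * f) * (e * r * f) = e * r * (f * e) * (r * f) := by noncomm_ring
      _ = 0 := by rw [hfe]; simp
  have hy : (f * s * e) * (f * s * e) = 0 := by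
    calc (f * s * e) * (f * s * e) = f * s * (e * f) * (s * e) := by noncomm_ring
      _ = 0 := by rw [hef]; simp
  have h := aux_xy huu hx hy
  have e1 : (e * r * f) * (f * s * e) = (e * r * f * s) * e := by
    calc (e * r * f) * (f * s * e) = e * r * (f * f) * s * e := by noncomm_ring
      _ = _ := by rw [hf]
  rw [e1] at h
  have h' := aux_swap h
  have e2 : e * (e * r * f * s) = e * r * f * s := by
    calc e * (e * r * f * s) = (e * e) * r * f * s := by noncomm_ring
      _ = _ := by rw [he]
  rwa [e2] at h'

theorem stmt_14 (R : Type*) [Ring R] :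
    (∀ a : R, ∃ e q : R, a = e + q ∧ e ^ 2 = e ∧ IsNilpotent q ∧ e * q = q * e) ↔
      ((∀ a : R, ∃ e q : R, a = e + q ∧ e ^ 2 = e ∧ IsNilpotent q) ∧
        ∀ k : ℕ, 0 < k → ∀ u : Rˣ, IsNilpotent ((u : R) ^ (2 ^ k) - 1)) := by
  constructor
  · intro h
    refine ⟨fun a => ?_, fun k _ u => ?_⟩
    · obtain ⟨e, q, h1, h2, h3, _⟩ := h a
      exact ⟨e, q, h1, h2, h3⟩
    · obtain ⟨e, q, h1, h2, h3, h4⟩ := h (u : R)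
      have hq : Commute q (u : R) := by
        rw [h1]; exact Commute.add_right h4.symm (Commute.refl q)
      have hu : IsUnit e := by
        have := h3.neg.isUnit_add_left_of_commute u.isUnit hq.neg_left
        rwa [h1, add_neg_cancel_right] at this
      have he : e = 1 := by
        rw [sq] at h2
        exact hu.mul_left_cancel (by rw [h2, mul_one])
      have hn : IsNilpotent ((u : R) - 1) := by rw [h1, he]; simpa using h3
      rw [← mul_geom_sum]
      refine Commute.isNilpotent_mul_right ?_ hn
      refine Commute.sum_right _ _ _ fun i _ => ?_
      exact (((Commute.refl (u : R)).sub_left (Commute.one_left _)).pow_right i)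
  · rintro ⟨hnc, hk⟩ a
    have h2 := aux_two hnc
    have huu : ∀ u : Rˣ, IsNilpotent ((u : R) - 1) := fun u =>
      aux_uu h2 (by simpa using hk 1 one_pos u)
    apply aux_lift
    obtain ⟨e, q, ha, he, hq⟩ := hnc a
    rw [sq] at he
    have hf : (1 - e) * (1 - e) = 1 - e := by
      simp [mul_sub, sub_mul, he]
    have hef : e * (1 - e) = 0 := by rw [mul_sub, he]; simp
    have hfe : (1 - e) * e = 0 := by rw [sub_mul, he]; simp
    have hJ : e * q - q * e ∈ Ring.jacobson R := by
      have := sub_mem (aux_corner huu he hf hef hfe q) (aux_corner huu hf he hfe hef q)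
      convert this using 1
      noncomm_ring
    let φ := Ideal.Quotient.mk (Ring.jacobson R)
    have hc : φ e * φ q = φ q * φ e := by
      rw [← map_mul, ← map_mul]; exact Ideal.Quotient.eq.mpr hJ
    have hE : φ e * φ e = φ e := by rw [← map_mul, he]
    have hφ : φ (a - a ^ 2) = φ q * (1 - 2 * φ e - φ q) := by
      rw [ha, map_sub, map_pow, map_add, sq, mul_add, add_mul, add_mul, hE, hc, mul_sub, mul_sub,
        two_mul, mul_add]
      noncomm_ring
    have hnil : IsNilpotent (φ (a - a ^ 2)) := by
      rw [hφ]
      refine Commute.isNilpotent_mul_right ?_ (hq.map φ)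
      have hc' : Commute (φ q) (φ e) := hc.symm
      exact ((Commute.one_right _).sub_right ((Commute.ofNat_right _ 2).mul_right hc')).sub_right
        (Commute.refl _)
    obtain ⟨n, hn⟩ := hnil
    rw [← map_pow] at hn
    obtain ⟨m, hm⟩ := aux_nil huu (Ideal.Quotient.eq_zero_iff_mem.mp hn)
    exact ⟨n * m, by rw [pow_mul, hm]⟩
end

section
/- Let R be a ring and m, n positive integers with greatest common divisor d. If R is both an m-UU ring and an n-UU ring, then R is a d-UU ring. -/
theorem nilp_gcd_aux {R : Type*} [Ring R] (x : R) (m n : ℕ) :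
    IsNilpotent (x ^ m - 1) → IsNilpotent (x ^ n - 1) → IsNilpotent (x ^ (Nat.gcd m n) - 1) := by
  have hc : ∀ a b : ℕ, Commute (x ^ a) (x ^ b - 1) := fun a b =>
    (Commute.pow_pow_self x a b).sub_right (Commute.one_right _)
  have hcc : ∀ a b : ℕ, Commute (x ^ a - 1) (x ^ b - 1) := fun a b =>
    (hc a b).sub_left (Commute.one_left _)
  induction m, n using Nat.gcd.induction with
  | H0 n => intro _ h; simpa using h
  | H1 m n hm ih =>
    intro h1 h2
    rw [Nat.gcd_rec]
    refine ih ?_ h1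
    have h3 : IsNilpotent (x ^ (m * (n / m)) - 1) := by
      have hcs : Commute (x ^ m - 1) (∑ i ∈ Finset.range (n / m), (x ^ m) ^ i) := by
        refine Commute.sum_right _ _ _ fun i _ => ?_
        rw [← pow_mul]
        exact (hc _ _).symm
      rw [pow_mul, ← mul_geom_sum]
      exact hcs.isNilpotent_mul_right h1
    have h4 : IsNilpotent (x ^ (n % m) * (x ^ (m * (n / m)) - 1)) :=
      (hc _ _).isNilpotent_mul_left h3
    have e : x ^ (n % m) - 1 = (x ^ n - 1) - x ^ (n % m) * (x ^ (m * (n / m)) - 1) := by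
      rw [mul_sub, ← pow_add, Nat.mod_add_div]
      simp
    rw [e]
    exact Commute.isNilpotent_sub ((hc _ _).symm.mul_right (hcc _ _)) h2 h4

theorem stmt_15 (R : Type*) [Ring R] (m n d : ℕ) (hm : 0 < m) (hn : 0 < n)
    (hd : Nat.gcd m n = d)
    (hmUU : ∀ u : Rˣ, IsNilpotent ((u : R) ^ m - 1))
    (hnUU : ∀ u : Rˣ, IsNilpotent ((u : R) ^ n - 1)) :
    ∀ u : Rˣ, IsNilpotent ((u : R) ^ d - 1) := by
  intro u
  rw [← hd]
  exact nilp_gcd_aux _ m n (hmUU u) (hnUU u)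
end

section
/- Let f : R → S be a surjective ring homomorphism between rings whose kernel is nil, i.e., every x in R with f(x) = 0 is nilpotent. Then, for any positive integer n, R is an n-UU ring if and only if S is an n-UU ring. -/
theorem stmt_16 (R S : Type*) [Ring R] [Ring S] (f : R →+* S)
    (hsurj : Function.Surjective f) (hnil : ∀ x : R, f x = 0 → IsNilpotent x)
    (n : ℕ) (hn : 0 < n) :
    (∀ u : Rˣ, IsNilpotent ((u : R) ^ n - 1)) ↔
      (∀ v : Sˣ, IsNilpotent ((v : S) ^ n - 1)) := by
  constructor
  · intro h v
    obtain ⟨a, ha⟩ := hsurj v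
    obtain ⟨b, hb⟩ := hsurj (v⁻¹ : Sˣ)
    have h1 : IsUnit (a * b) := by
      have := (hnil (a * b - 1) (by simp [ha, hb])).isUnit_one_add
      simpa using this
    have h2 : IsUnit (b * a) := by
      have := (hnil (b * a - 1) (by simp [ha, hb])).isUnit_one_add
      simpa using this
    have hu : IsUnit a := by
      rw [isUnit_iff_exists_and_exists]
      obtain ⟨c, hc⟩ := h1.exists_right_inv
      obtain ⟨d, hd⟩ := h2.exists_left_inv
      exact ⟨⟨b * c, by rw [← mul_assoc, hc]⟩, ⟨d * b, by rw [mul_assoc, hd]⟩⟩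
    obtain ⟨u, rfl⟩ := hu
    have := (h u).map f
    simpa [ha] using this
  · intro h u
    obtain ⟨k, hk⟩ := h (Units.map (f : R →* S) u)
    have hz : f (((u : R) ^ n - 1) ^ k) = 0 := by
      simpa using hk
    obtain ⟨m, hm⟩ := hnil _ hz
    exact ⟨k * m, by rw [pow_mul, hm]⟩
end

section
/- Let R be a nonzero ring and m ≥ 3 an integer. Then the ring of m × m matrices over R is not a 3-UU ring: there exists an invertible m × m matrix A over R such that A^3 - I is not nilpotent. -/
theorem stmt_17 (R : Type*) [Ring R] [Nontrivial R] (m : ℕ) (hm : 3 ≤ m) :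
    ∃ A : (Matrix (Fin m) (Fin m) R)ˣ,
      ¬ IsNilpotent ((A.val : Matrix (Fin m) (Fin m) R) ^ 3 - 1) := by
  obtain ⟨k, rfl⟩ := Nat.exists_eq_add_of_le hm
  obtain ⟨B, hB⟩ : ∃ B : Matrix (Fin 3) (Fin 3) R, B * B * B = B + 1 := by
    refine ⟨!![0, 0, 1; 1, 0, 1; 0, 1, 0], ?_⟩
    ext i j
    fin_cases i <;> fin_cases j <;> simp [Matrix.mul_apply, Fin.sum_univ_three]
  have h1 : B * (B * B - 1) = 1 := by
    rw [mul_sub, ← mul_assoc, hB]; simp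
  have h2 : (B * B - 1) * B = 1 := by
    rw [sub_mul, hB]; simp
  let e : Matrix (Fin 3 ⊕ Fin k) (Fin 3 ⊕ Fin k) R ≃+* Matrix (Fin (3 + k)) (Fin (3 + k)) R :=
    Matrix.reindexRingEquiv R finSumFinEquiv
  let M : (Matrix (Fin 3 ⊕ Fin k) (Fin 3 ⊕ Fin k) R)ˣ :=
    ⟨Matrix.fromBlocks B 0 0 1, Matrix.fromBlocks (B * B - 1) 0 0 1,
      by simp [Matrix.fromBlocks_multiply, h1], by simp [Matrix.fromBlocks_multiply, h2]⟩
  have hM : M.val ^ 3 - 1 = Matrix.fromBlocks B 0 0 0 := by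
    change Matrix.fromBlocks B 0 0 1 ^ 3 - 1 = _
    rw [sub_eq_iff_eq_add, pow_succ, pow_two, ← Matrix.fromBlocks_one, Matrix.fromBlocks_add]
    simp [Matrix.fromBlocks_multiply, hB]
  refine ⟨Units.map e.toMonoidHom M, ?_⟩
  have h3 : ((Units.map e.toMonoidHom M).val ^ 3 - 1) = e (M.val ^ 3 - 1) := by
    rw [map_sub, map_pow, map_one]; rfl
  rw [h3, hM]
  rintro ⟨n, hn⟩
  rw [← map_pow, map_eq_zero_iff e e.injective] at hn
  rw [Matrix.fromBlocks_diagonal_pow, ← Matrix.fromBlocks_zero, Matrix.fromBlocks_inj] at hn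
  have hu : IsUnit B := ⟨⟨B, B * B - 1, h1, h2⟩, rfl⟩
  have := hu.pow n
  rw [hn.1] at this
  exact not_isUnit_zero this
end

section
/- Let R be a nonzero ring and n a positive integer. Then the formal power series ring R[[X]] is not an n-UU ring: there exists a unit u of R[[X]] such that u^n - 1 is not nilpotent. -/
theorem stmt_18 (R : Type*) [Ring R] [Nontrivial R] (n : ℕ) (hn : 0 < n) :
    ∃ u : (PowerSeries R)ˣ, ¬ IsNilpotent ((u : PowerSeries R) ^ n - 1) := by
  have hu : IsUnit (((Polynomial.X + Polynomial.C 1 : Polynomial ℤ)) : PowerSeries ℤ) := by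
    rw [PowerSeries.isUnit_iff_constantCoeff]
    simp
  have hmon : (((Polynomial.X + Polynomial.C 1 : Polynomial ℤ)) ^ n - 1).Monic := by
    apply Polynomial.Monic.sub_of_left ((Polynomial.monic_X_add_C 1).pow n)
    rw [Polynomial.degree_pow, Polynomial.degree_X_add_C, Polynomial.degree_one]
    simpa using hn
  obtain ⟨v, hv⟩ := hu
  refine ⟨Units.map (PowerSeries.map (Int.castRingHom R)).toMonoidHom v, ?_⟩
  rintro ⟨k, hk⟩
  have h1 : ((Units.map (PowerSeries.map (Int.castRingHom R)).toMonoidHom v : (PowerSeries R)ˣ) :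
      PowerSeries R) = PowerSeries.map (Int.castRingHom R) (v : PowerSeries ℤ) := rfl
  have hm := hmon.pow k
  set p := (((Polynomial.X + Polynomial.C 1 : Polynomial ℤ)) ^ n - 1) ^ k with hp
  have h2 : PowerSeries.map (Int.castRingHom R) (p : PowerSeries ℤ) = 0 := by
    rw [← hk, h1, hv, hp]
    simp
  have h3 := congrArg (PowerSeries.coeff p.natDegree) h2
  rw [PowerSeries.coeff_map, Polynomial.coeff_coe, hm.coeff_natDegree] at h3
  simp at h3
end

section
/- Let R be a ring of finite characteristic m with m > 1, let G be a group, and let n be a positive integer. If the group ring RG is an n-UU ring, then R is an n-UU ring and G is torsion with all torsion of the appropriate type: for every g in G there exists a natural number s such that g^(n · m^s) = 1. -/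
theorem aux_expand {A : Type*} [Ring A] (x : A) (j : ℕ) :
    ∃ y : A, Commute x y ∧ (1 + x) ^ j = 1 + (j : A) * x + x ^ 2 * y := by
  induction j with
  | zero => exact ⟨0, Commute.zero_right x, by simp⟩
  | succ j ih =>
    obtain ⟨y, hc, h⟩ := ih
    refine ⟨(j : A) + y + x * y, ?_, ?_⟩
    · exact (((Nat.cast_commute j x).symm).add_right hc).add_right
        ((Commute.refl x).mul_right hc)
    · have e : y * x = x * y := hc.eq.symm
      have e2 : x * (j : A) = (j : A) * x := ((Nat.cast_commute j x).symm).eq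
      have e3 : x ^ 2 * (j : A) = (j : A) * x * x := by
        rw [pow_two, mul_assoc, e2, ← mul_assoc, e2]
      rw [pow_succ, h]
      have e4 : x ^ 2 * y * x = x ^ 2 * (x * y) := by rw [mul_assoc, e]
      push_cast
      simp only [mul_add, add_mul, mul_one, one_mul, e3, e4]
      abel

theorem aux_pow {A : Type*} [Ring A] (m : ℕ) (hm : (m : A) = 0) (k : ℕ) :
    ∀ h : A, (h - 1) ^ (k + 1) = 0 → ∃ s : ℕ, h ^ (m ^ s) = 1 := by
  induction k with
  | zero =>
    intro h hh
    exact ⟨0, by simpa [sub_eq_zero] using hh⟩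
  | succ k ih =>
    intro h hh
    obtain ⟨y, hc, e⟩ := aux_expand (h - 1) m
    rw [hm, add_sub_cancel] at e
    obtain ⟨s, hs⟩ := ih (h ^ m) (by
      have e1 : h ^ m - 1 = (h - 1) ^ 2 * y := by rw [e]; simp
      rw [e1, (hc.pow_left 2).mul_pow, ← pow_mul,
        show 2 * (k + 1) = (k + 1 + 1) + k by ring, pow_add, hh]
      simp)
    exact ⟨s + 1, by rw [pow_succ', pow_mul, hs]⟩

theorem stmt_19 (R : Type*) [Ring R] (G : Type*) [Group G] (m n : ℕ)
    (hm : 1 < m) [CharP R m] (hn : 0 < n)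
    (hUU : ∀ u : (MonoidAlgebra R G)ˣ, IsNilpotent ((u : MonoidAlgebra R G) ^ n - 1)) :
    (∀ u : Rˣ, IsNilpotent ((u : R) ^ n - 1)) ∧
      (∀ g : G, ∃ s : ℕ, g ^ (n * m ^ s) = 1) := by
  have : Nontrivial R := CharP.nontrivial_of_char_ne_one (v := m) (by omega)
  constructor
  · intro u
    have h := hUU (Units.map (MonoidAlgebra.singleOneRingHom (R := R) (M := G)).toMonoidHom u)
    have hinj : Function.Injective (MonoidAlgebra.singleOneRingHom (R := R) (M := G)) := by
      intro a b hab
      have h2 : (MonoidAlgebra.single (1 : G) a) = MonoidAlgebra.single (1 : G) b := hab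
      simpa using h2
    rw [← IsNilpotent.map_iff hinj]
    rw [map_sub, map_pow, map_one]
    exact h
  · intro g
    have h := hUU (Units.map (MonoidAlgebra.of R G) (toUnits g))
    obtain ⟨k, hk⟩ := h
    have hm0 : ((m : ℕ) : MonoidAlgebra R G) = 0 := by
      rw [← map_natCast (MonoidAlgebra.singleOneRingHom (R := R) (M := G)), CharP.cast_eq_zero,
        map_zero]
    obtain ⟨s, hs⟩ := aux_pow m hm0 k _ (by rw [pow_succ, hk, zero_mul])
    refine ⟨s, MonoidAlgebra.of_injective (R := R) ?_⟩
    rw [map_one, map_pow, pow_mul]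
    exact hs
end
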